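/- Let ψ ∈ S_0(ℝ²) and let f be a tempered distribution on ℝ² (representing an element of S_0'(ℝ²)). Then the function S_ψ f(b,s,a) = (f, π_{b,s,a}ψ) is smooth on 𝕊 and of at most polynomial growth: there exist C, ν₁, ν₂, ν₃ > 0 such that |S_ψ f(b,s,a)| ≤ C ⟨b⟩^{ν₁} ⟨s⟩^{ν₂} (|a|^{ν₃} + |a|^{-ν₃}) for all (b,s,a) ∈ 𝕊. -/

import Mathlib

open MeasureTheory Complex SchwartzMap
open scoped FourierTransform RealInnerProductSpace

noncomputable section

abbrev E2 := EuclideanSpace ℝ (Fin 2)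

/-- construct a point of ℝ² -/
def e2 (u v : ℝ) : E2 := (WithLp.equiv 2 (Fin 2 → ℝ)).symm ![u, v]

/-- Japanese bracket ⟨x⟩ = (1+‖x‖²)^{1/2}. -/
def jp {E : Type*} [NormedAddCommGroup E] (x : E) : ℝ := Real.sqrt (1 + ‖x‖^2)

/-- Schwartz seminorms ρ_ν. -/
def rho {E : Type*} [NormedAddCommGroup E] [NormedSpace ℝ E] (ν : ℕ) (f : E → ℂ) : ℝ :=
  ⨆ p : E × Fin (ν + 1), jp p.1 ^ ν * ‖iteratedFDeriv ℝ p.2 f p.1‖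

/-- Lizorkin membership on ℝ²: Schwartz with all vanishing moments. -/
def IsLizorkin2 (f : E2 → ℂ) : Prop :=
  (∃ g : SchwartzMap E2 ℂ, ⇑g = f) ∧
    ∀ m₁ m₂ : ℕ, ∫ x : E2, ((x 0) ^ m₁ * (x 1) ^ m₂ : ℝ) • f x = 0

/-- shearlet representation π_{b,s,a}ψ -/
def srep (ψ : E2 → ℂ) (b : E2) (s a : ℝ) (x : E2) : ℂ :=
  (|a| ^ (-(3:ℝ)/4) : ℝ) •
    ψ (e2 ((x 0 - b 0 + s * (x 1 - b 1)) / a) (Real.sqrt |a| * (x 1 - b 1) / a))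

/-- shearlet transform 𝒮_ψ f (b,s,a) = ⟨f, π_{b,s,a}ψ⟩ -/
def sTrans (ψ f : E2 → ℂ) (b : E2) (s a : ℝ) : ℂ :=
  ∫ x : E2, f x * (starRingEnd ℂ) (srep ψ b s a x)

/-- shearlet synthesis operator -/
def sSynth (ψ : E2 → ℂ) (Φ : ℝ → ℝ → ℝ → ℝ → ℂ) (x : E2) : ℂ :=
  ∫ p : ℝ × ℝ × ℝ × ℝ,
    (|p.2.2.2| ^ (-(3:ℝ)) : ℝ) •
      (Φ p.1 p.2.1 p.2.2.1 p.2.2.2 * srep ψ (e2 p.1 p.2.1) p.2.2.1 p.2.2.2 x)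

/-- mixed partial derivative ∂_a^γ ∂_s^β ∂_{b₂}^{α₂} ∂_{b₁}^{α₁} Φ -/
def mixedD (α₁ α₂ β γ : ℕ) (Φ : ℝ → ℝ → ℝ → ℝ → ℂ) (b₁ b₂ s a : ℝ) : ℂ :=
  iteratedDeriv γ (fun a' => iteratedDeriv β (fun s' =>
    iteratedDeriv α₂ (fun y => iteratedDeriv α₁ (fun x => Φ x y s' a') b₁) b₂) s) a

/-- the weight in the norms of 𝒮(𝕊), with real exponent m -/
def wS (k₁ k₂ l : ℕ) (m : ℝ) (b₁ b₂ s a : ℝ) : ℝ :=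
  jp b₁ ^ k₁ * jp b₂ ^ k₂ * jp s ^ l * (|a| ^ m + |a| ^ (-m))

/-- the norms p^{α₁,α₂,β,γ}_{k₁,k₂,l,m} on 𝒮(𝕊) -/
def pN (k₁ k₂ l : ℕ) (m : ℝ) (α₁ α₂ β γ : ℕ) (Φ : ℝ → ℝ → ℝ → ℝ → ℂ) : ℝ :=
  ⨆ q : ℝ × ℝ × ℝ × {a : ℝ // a ≠ 0},
    wS k₁ k₂ l m q.1 q.2.1 q.2.2.1 q.2.2.2 *
      ‖mixedD α₁ α₂ β γ Φ q.1 q.2.1 q.2.2.1 q.2.2.2‖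

/-- membership in the test function space 𝒮(𝕊) -/
def MemSS (Φ : ℝ → ℝ → ℝ → ℝ → ℂ) : Prop :=
  ContDiffOn ℝ (⊤ : ℕ∞) (fun p : ℝ × ℝ × ℝ × ℝ => Φ p.1 p.2.1 p.2.2.1 p.2.2.2)
      {p : ℝ × ℝ × ℝ × ℝ | p.2.2.2 ≠ 0} ∧
    ∀ k₁ k₂ l m α₁ α₂ β γ : ℕ, ∃ C : ℝ, ∀ b₁ b₂ s a : ℝ, a ≠ 0 →
      wS k₁ k₂ l (m : ℝ) b₁ b₂ s a * ‖mixedD α₁ α₂ β γ Φ b₁ b₂ s a‖ ≤ C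


open scoped ContDiff BoundedContinuousFunction LineDeriv

/-- The `i`-th standard basis vector of the plane. -/
def stdVec (i : Fin 2) : E2 := EuclideanSpace.single i 1

theorem sum_smul_stdVec (x : E2) : ∑ i, x i • stdVec i = x := by
  ext j
  fin_cases j <;> simp [stdVec]

/-- The partial derivative in the direction of the `i`-th coordinate. -/
def partialDeriv (i : Fin 2) : 𝓢(E2, ℂ) →ₗ[ℝ] 𝓢(E2, ℂ) :=
  (LineDeriv.lineDerivOpCLM ℝ 𝓢(E2, ℂ) (stdVec i)).toLinearMap

theorem partialDeriv_apply (i : Fin 2) (φ : 𝓢(E2, ℂ)) (x : E2) :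
    partialDeriv i φ x = fderiv ℝ φ x (stdVec i) :=
  rfl

/-- Multiplication by the `j`-th coordinate. -/
def coordMul (j : Fin 2) : 𝓢(E2, ℂ) →ₗ[ℝ] 𝓢(E2, ℂ) :=
  (smulLeftCLM ℂ (fun x : E2 => x j)).toLinearMap

theorem coordMul_apply (j : Fin 2) (φ : 𝓢(E2, ℂ)) (x : E2) :
    coordMul j φ x = x j • φ x :=
  smulLeftCLM_apply_apply (EuclideanSpace.proj j : E2 →L[ℝ] ℝ).hasTemperateGrowth φ x

theorem fderiv_eq_sum_partialDeriv (φ : 𝓢(E2, ℂ)) (x k : E2) :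
    fderiv ℝ φ x k = ∑ i, k i • partialDeriv i φ x := by
  conv_lhs => rw [← sum_smul_stdVec k]
  simp only [map_sum, map_smul, partialDeriv_apply]

/-- A second order Taylor estimate that keeps track of decay at infinity. -/
theorem SchwartzMap.exists_taylor_bound {E F : Type*} [NormedAddCommGroup E] [NormedSpace ℝ E]
    [NormedAddCommGroup F] [NormedSpace ℝ F] (φ : 𝓢(E, F)) :
    ∃ C : ℝ, 0 ≤ C ∧ ∀ y k : E, ∀ r : ℝ, 0 ≤ r → r ≤ 1 / 2 → ‖k‖ ≤ r * (1 + ‖y‖) →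
      ‖φ (y + k) - φ y - fderiv ℝ φ y k‖ ≤ C * r ^ 2 := by
  set φ₁ := fderivCLM ℝ E F φ with hφ₁
  set φ₂ := fderivCLM ℝ E (E →L[ℝ] F) φ₁ with hφ₂
  have hC : ∃ C : ℝ, 0 ≤ C ∧ ∀ z, (1 + ‖z‖) ^ 2 * ‖φ₂ z‖ ≤ C := by
    refine ⟨_, ?_, fun z => by
      simpa using one_add_le_sup_seminorm_apply (𝕜 := ℝ) (m := (2, 0)) le_rfl le_rfl φ₂ z⟩
    positivity
  obtain ⟨C, hC0, hC⟩ := hC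
  refine ⟨4 * C, by positivity, fun y k r hr0 hr hk => ?_⟩
  have hy : 0 < 1 + ‖y‖ := by positivity
  set B := 4 * C / (1 + ‖y‖) ^ 2 with hB
  have hB0 : 0 ≤ B := by positivity
  have h2 : ∀ z ∈ Metric.closedBall y ‖k‖, ‖φ₂ z‖ ≤ B := by
    intro z hz
    rw [mem_closedBall_iff_norm'] at hz
    have h3 : ‖y‖ ≤ ‖z‖ + ‖y - z‖ := by
      simpa [add_comm] using norm_le_norm_add_norm_sub' y z
    have h4 : (1 + ‖y‖) / 2 ≤ 1 + ‖z‖ := by nlinarith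
    rw [hB, le_div_iff₀ (by positivity)]
    have h5 : ((1 + ‖y‖) / 2) ^ 2 * ‖φ₂ z‖ ≤ C :=
      le_trans (by gcongr) (hC z)
    linarith
  have hconv := convex_closedBall y ‖k‖
  have hy_mem : y ∈ Metric.closedBall y ‖k‖ := Metric.mem_closedBall_self (norm_nonneg _)
  have h1 : ∀ z ∈ Metric.closedBall y ‖k‖, ‖fderiv ℝ φ z - fderiv ℝ φ y‖ ≤ B * ‖k‖ := by
    intro z hz
    refine (hconv.norm_image_sub_le_of_norm_hasFDerivWithin_le (f := φ₁) (f' := φ₂)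
      (fun x _ => (φ₁.hasFDerivAt x).hasFDerivWithinAt) h2 hy_mem hz).trans ?_
    gcongr
    exact mem_closedBall_iff_norm.1 hz
  have h0 := hconv.norm_image_sub_le_of_norm_hasFDerivWithin_le' (f := φ) (f' := fderiv ℝ φ)
    (φ := fderiv ℝ φ y) (fun x _ => (φ.hasFDerivAt x).hasFDerivWithinAt) h1 hy_mem
    (y := y + k) (by simp)
  rw [add_sub_cancel_left] at h0
  calc _ ≤ B * ‖k‖ * ‖k‖ := h0
    _ ≤ B * (r * (1 + ‖y‖)) * (r * (1 + ‖y‖)) := by gcongr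
    _ = 4 * C * r ^ 2 := by rw [hB]; field_simp

/-- Parameters of an affine map `x ↦ M x + v` of the plane. -/
abbrev AffineParam := (E2 →L[ℝ] E2) × E2

/-- The bounded continuous function `x ↦ φ (M x + v)`. -/
def affinePullback (φ : 𝓢(E2, ℂ)) (q : AffineParam) : E2 →ᵇ ℂ :=
  φ.toBoundedContinuousFunction.compContinuous ⟨fun x => q.1 x + q.2, by fun_prop⟩

@[simp]
theorem affinePullback_apply (φ : 𝓢(E2, ℂ)) (q : AffineParam) (x : E2) :
    affinePullback φ q x = φ (q.1 x + q.2) :=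
  rfl

/-- The functional `(M, v) ↦ (M u) i`, as a function of `u`. -/
def evalCoord (i : Fin 2) : E2 →L[ℝ] AffineParam →L[ℝ] ℝ :=
  (ContinuousLinearMap.compL ℝ AffineParam E2 ℝ (EuclideanSpace.proj i)).comp
    (((ContinuousLinearMap.compL ℝ AffineParam (E2 →L[ℝ] E2) E2).flip
      (ContinuousLinearMap.fst ℝ _ _)).comp (ContinuousLinearMap.apply ℝ E2))

@[simp]
theorem evalCoord_apply (i : Fin 2) (u : E2) (q : AffineParam) : evalCoord i u q = (q.1 u) i :=
  rfl

/-- The functional `(M, v) ↦ v i`. -/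
def shiftCoord (i : Fin 2) : AffineParam →L[ℝ] ℝ :=
  (EuclideanSpace.proj i : E2 →L[ℝ] ℝ).comp (ContinuousLinearMap.snd ℝ _ _)

@[simp]
theorem shiftCoord_apply (i : Fin 2) (q : AffineParam) : shiftCoord i q = q.2 i :=
  rfl

/-- The derivative of `affinePullback φ` at `(M, v)`, where `N` is the inverse of `M`. -/
def affinePullbackDeriv (φ : 𝓢(E2, ℂ)) (N : E2 →L[ℝ] E2) (q : AffineParam) :
    AffineParam →L[ℝ] (E2 →ᵇ ℂ) :=
  ∑ i, ((shiftCoord i - evalCoord i (N q.2)).smulRight (affinePullback (partialDeriv i φ) q) +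
    ∑ j, (evalCoord i (N (stdVec j))).smulRight
      (affinePullback (coordMul j (partialDeriv i φ)) q))

theorem affinePullbackDeriv_apply_apply (φ : 𝓢(E2, ℂ)) {N : E2 →L[ℝ] E2} {q : AffineParam}
    (hN : ∀ x, N (q.1 x) = x) (h : AffineParam) (x : E2) :
    affinePullbackDeriv φ N q h x = fderiv ℝ φ (q.1 x + q.2) (h.1 x + h.2) := by
  rw [fderiv_eq_sum_partialDeriv]
  set y := q.1 x + q.2 with hy
  have hx : h.1 x = ∑ j, y j • h.1 (N (stdVec j)) - h.1 (N q.2) := by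
    have : ∑ j, y j • h.1 (N (stdVec j)) = h.1 (N y) := by
      conv_rhs => rw [← sum_smul_stdVec y]
      simp only [map_sum, map_smul]
    rw [this, hy, map_add, hN, map_add, add_sub_cancel_right]
  rw [hx]
  simp only [affinePullbackDeriv, evalCoord_apply, shiftCoord_apply, Fin.sum_univ_two,
    add_apply, sub_apply, ContinuousLinearMap.smulRight_apply,
    BoundedContinuousFunction.smul_apply, BoundedContinuousFunction.add_apply,
    affinePullback_apply, coordMul_apply, PiLp.add_apply, PiLp.sub_apply, PiLp.smul_apply,
    ← hy, Complex.real_smul, smul_eq_mul]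
  push_cast
  ring

theorem hasFDerivAt_affinePullback (φ : 𝓢(E2, ℂ)) {N : E2 →L[ℝ] E2} {q : AffineParam}
    (hN : ∀ x, N (q.1 x) = x) :
    HasFDerivAt (affinePullback φ) (affinePullbackDeriv φ N q) q := by
  obtain ⟨C, hC0, hC⟩ := φ.exists_taylor_bound
  set K := ‖N‖ * (1 + ‖q.2‖) + 1 with hK
  have hK0 : 0 < K := by positivity
  have hpert : ∀ (h : AffineParam) (x : E2),
      ‖h.1 x + h.2‖ ≤ (K * ‖h‖) * (1 + ‖q.1 x + q.2‖) := by
    intro h x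
    have hx : ‖x‖ ≤ ‖N‖ * (‖q.1 x + q.2‖ + ‖q.2‖) := by
      calc ‖x‖ = ‖N ((q.1 x + q.2) - q.2)‖ := by rw [add_sub_cancel_right, hN]
        _ ≤ ‖N‖ * ‖(q.1 x + q.2) - q.2‖ := N.le_opNorm _
        _ ≤ _ := by gcongr; exact norm_sub_le _ _
    have h1 : ‖h.1‖ ≤ ‖h‖ := norm_fst_le h
    have h2 : ‖h.2‖ ≤ ‖h‖ := norm_snd_le h
    calc ‖h.1 x + h.2‖ ≤ ‖h.1‖ * ‖x‖ + ‖h.2‖ :=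
          (norm_add_le _ _).trans (by gcongr; exact h.1.le_opNorm x)
      _ ≤ ‖h‖ * (‖N‖ * (‖q.1 x + q.2‖ + ‖q.2‖)) + ‖h‖ := by gcongr
      _ ≤ _ := by
        rw [hK]
        have : 0 ≤ ‖h‖ * (‖N‖ * (‖q.2‖ * ‖q.1 x + q.2‖ + 1) + ‖q.1 x + q.2‖) := by positivity
        nlinarith
  rw [hasFDerivAt_iff_isLittleO_nhds_zero]
  refine Asymptotics.IsBigO.trans_isLittleO (g := fun h : AffineParam => ‖h‖ ^ 2) ?_
    (Asymptotics.isLittleO_norm_pow_id one_lt_two)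
  refine Asymptotics.IsBigO.of_bound (C * K ^ 2) ?_
  filter_upwards [Metric.ball_mem_nhds (0 : AffineParam) (show 0 < 1 / (2 * K) by positivity)]
    with h hh
  rw [mem_ball_zero_iff, lt_div_iff₀ (by positivity)] at hh
  rw [norm_pow, norm_norm, mul_assoc, ← mul_pow]
  refine (BoundedContinuousFunction.norm_le (by positivity)).2 fun x => ?_
  have := hC (q.1 x + q.2) (h.1 x + h.2) (K * ‖h‖) (by positivity) (by linarith) (hpert h x)
  simpa only [BoundedContinuousFunction.sub_apply, affinePullbackDeriv_apply_apply φ hN,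
    affinePullback_apply, Prod.fst_add, Prod.snd_add, add_apply,
    add_add_add_comm (q.1 x)] using this

/-- The parameters of invertible affine maps. -/
def invertibleParams : Set AffineParam :=
  {q | q.1 ∈ Set.range ((↑) : (E2 ≃L[ℝ] E2) → E2 →L[ℝ] E2)}

theorem isOpen_invertibleParams : IsOpen invertibleParams :=
  (ContinuousLinearEquiv.isOpen).preimage continuous_fst

theorem inverse_apply_of_mem_invertibleParams {q : AffineParam} (hq : q ∈ invertibleParams)
    (x : E2) : q.1.inverse (q.1 x) = x := by
  obtain ⟨e, he⟩ := hq
  rw [← he, ContinuousLinearMap.inverse_equiv]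
  exact e.symm_apply_apply x

theorem contDiffOn_inverse_invertibleParams (n : WithTop ℕ∞) :
    ContDiffOn ℝ n (fun q : AffineParam => q.1.inverse) invertibleParams := by
  rintro q ⟨e, he⟩
  have h := contDiffAt_map_inverse (𝕜 := ℝ) (n := n) e
  rw [he] at h
  exact (h.comp q contDiffAt_fst).contDiffWithinAt

theorem contDiff_evalCoord (i : Fin 2) (n : WithTop ℕ∞) :
    ContDiff ℝ n (fun u => evalCoord i u) := by
  fun_prop

theorem contDiffOn_affinePullback_nat (n : ℕ) (φ : 𝓢(E2, ℂ)) :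
    ContDiffOn ℝ n (affinePullback φ) invertibleParams := by
  induction n generalizing φ with
  | zero =>
    refine contDiffOn_zero.2 fun q hq => ?_
    exact (hasFDerivAt_affinePullback φ
      (inverse_apply_of_mem_invertibleParams hq)).continuousAt.continuousWithinAt
  | succ n ih =>
    rw [Nat.cast_add, Nat.cast_one, contDiffOn_succ_iff_hasFDerivWithinAt_of_uniqueDiffOn
      isOpen_invertibleParams.uniqueDiffOn]
    refine ⟨fun h => by simp at h, fun q => affinePullbackDeriv φ q.1.inverse q, ?_, fun q hq =>
      (hasFDerivAt_affinePullback φ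
        (inverse_apply_of_mem_invertibleParams hq)).hasFDerivWithinAt⟩
    have hinv := contDiffOn_inverse_invertibleParams (n : WithTop ℕ∞)
    unfold affinePullbackDeriv
    refine ContDiffOn.sum fun i _ => ContDiffOn.add ?_ (ContDiffOn.sum fun j _ => ?_)
    · have hu : ContDiffOn ℝ n (fun q : AffineParam => q.1.inverse q.2) invertibleParams :=
        hinv.clm_apply contDiffOn_snd
      have hl : ContDiffOn ℝ n (fun q : AffineParam => evalCoord i (q.1.inverse q.2))
          invertibleParams := (contDiff_evalCoord i n).comp_contDiffOn hu
      have hs : ContDiffOn ℝ n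
          (fun q : AffineParam => shiftCoord i - evalCoord i (q.1.inverse q.2))
          invertibleParams := contDiffOn_const.sub hl
      exact hs.smulRight (ih (partialDeriv i φ))
    · have hu : ContDiffOn ℝ n (fun q : AffineParam => q.1.inverse (stdVec j))
          invertibleParams := hinv.clm_apply contDiffOn_const
      have hl : ContDiffOn ℝ n (fun q : AffineParam => evalCoord i (q.1.inverse (stdVec j)))
          invertibleParams := (contDiff_evalCoord i n).comp_contDiffOn hu
      exact hl.smulRight (ih (coordMul j (partialDeriv i φ)))

theorem contDiffOn_affinePullback (φ : 𝓢(E2, ℂ)) :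
    ContDiffOn ℝ ∞ (affinePullback φ) invertibleParams :=
  contDiffOn_infty.2 fun n => contDiffOn_affinePullback_nat n φ

/-- The linear map `x ↦ x j • e i`. -/
def matUnit (i j : Fin 2) : E2 →L[ℝ] E2 :=
  (EuclideanSpace.proj j : E2 →L[ℝ] ℝ).smulRight (stdVec i)

/-- The linear map with the matrix `m`. -/
def matMap (m : Fin 2 → Fin 2 → ℝ) : E2 →L[ℝ] E2 :=
  ∑ i, ∑ j, m i j • matUnit i j

theorem matMap_apply (m : Fin 2 → Fin 2 → ℝ) (x : E2) (i : Fin 2) :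
    matMap m x i = ∑ j, m i j * x j := by
  fin_cases i <;> simp [matMap, matUnit, stdVec]

/-- The matrix of `x ↦ A_a⁻¹ N_s⁻¹ x`. -/
def shearMatrix (p : E2 × ℝ × ℝ) : Fin 2 → Fin 2 → ℝ :=
  ![![p.2.2⁻¹, p.2.1 * p.2.2⁻¹], ![0, |p.2.2| ^ (1 / 2 : ℝ) * p.2.2⁻¹]]

/-- The matrix of `x ↦ N_s A_a x`. -/
def shearMatrixInv (p : E2 × ℝ × ℝ) : Fin 2 → Fin 2 → ℝ :=
  ![![p.2.2, (-1) * (p.2.1 * (p.2.2 * |p.2.2| ^ (-(1 / 2) : ℝ)))],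
    ![0, p.2.2 * |p.2.2| ^ (-(1 / 2) : ℝ)]]

/-- The parameter of the affine map `x ↦ A_a⁻¹ N_s⁻¹ (x - b)`. -/
def shearParam (p : E2 × ℝ × ℝ) : AffineParam :=
  (matMap (shearMatrix p), -matMap (shearMatrix p) p.1)

theorem shearParam_apply (p : E2 × ℝ × ℝ) (x : E2) :
    (shearParam p).1 x + (shearParam p).2 = matMap (shearMatrix p) (x - p.1) := by
  simp [shearParam, sub_eq_add_neg]

theorem rpow_half_mul_rpow_neg_half {a : ℝ} (ha : a ≠ 0) :
    |a| ^ (1 / 2 : ℝ) * |a| ^ (-(1 / 2) : ℝ) = 1 := by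
  rw [← Real.rpow_add (abs_pos.2 ha)]
  simp

theorem matMap_shearMatrixInv_apply {p : E2 × ℝ × ℝ} (hp : p.2.2 ≠ 0) (x : E2) :
    matMap (shearMatrixInv p) (matMap (shearMatrix p) x) = x := by
  have h := rpow_half_mul_rpow_neg_half hp
  ext i
  fin_cases i
  · simp only [matMap_apply, Fin.sum_univ_two, shearMatrix, shearMatrixInv]
    simp
    field_simp
    linear_combination (-(p.2.1 * x 1)) * h
  · simp only [matMap_apply, Fin.sum_univ_two, shearMatrix, shearMatrixInv]
    simp
    field_simp
    linear_combination x 1 * h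

theorem matMap_shearMatrix_apply {p : E2 × ℝ × ℝ} (hp : p.2.2 ≠ 0) (x : E2) :
    matMap (shearMatrix p) (matMap (shearMatrixInv p) x) = x := by
  have h := rpow_half_mul_rpow_neg_half hp
  ext i
  fin_cases i
  · simp only [matMap_apply, Fin.sum_univ_two, shearMatrix, shearMatrixInv]
    simp
    field_simp
    ring
  · simp only [matMap_apply, Fin.sum_univ_two, shearMatrix, shearMatrixInv]
    simp
    field_simp
    linear_combination x 1 * h

theorem shearParam_mem_invertibleParams {p : E2 × ℝ × ℝ} (hp : p.2.2 ≠ 0) :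
    shearParam p ∈ invertibleParams :=
  ⟨ContinuousLinearEquiv.equivOfInverse (matMap (shearMatrix p)) (matMap (shearMatrixInv p))
    (matMap_shearMatrixInv_apply hp) (matMap_shearMatrix_apply hp), rfl⟩

/-- Composition of Schwartz functions with the affine map `x ↦ A_a⁻¹ N_s⁻¹ (x - b)`;
zero when `a = 0`. -/
def shearComp (p : E2 × ℝ × ℝ) : 𝓢(E2, ℂ) →L[ℝ] 𝓢(E2, ℂ) :=
  if hp : p.2.2 ≠ 0 then
    (compSubConstCLM ℝ p.1).comp (compCLMOfContinuousLinearEquiv ℝ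
      (ContinuousLinearEquiv.equivOfInverse (matMap (shearMatrix p)) (matMap (shearMatrixInv p))
        (matMap_shearMatrixInv_apply hp) (matMap_shearMatrix_apply hp)))
  else 0

theorem shearComp_apply {p : E2 × ℝ × ℝ} (hp : p.2.2 ≠ 0) (φ : 𝓢(E2, ℂ)) (x : E2) :
    shearComp p φ x = φ (matMap (shearMatrix p) (x - p.1)) := by
  rw [shearComp, dif_pos hp]
  rfl

theorem srep_eq_shearComp (ψ : 𝓢(E2, ℂ)) {p : E2 × ℝ × ℝ} (hp : p.2.2 ≠ 0) (x : E2) :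
    srep ψ p.1 p.2.1 p.2.2 x = (|p.2.2| ^ (-(3 : ℝ) / 4)) • shearComp p ψ x := by
  rw [srep, shearComp_apply hp]
  congr 2
  ext i
  fin_cases i
  · simp [matMap_apply, shearMatrix, e2]
    ring
  · simp [matMap_apply, shearMatrix, e2, Real.sqrt_eq_rpow]
    ring

theorem partialDeriv_shearComp {p : E2 × ℝ × ℝ} (hp : p.2.2 ≠ 0) (φ : 𝓢(E2, ℂ)) (i : Fin 2) :
    partialDeriv i (shearComp p φ) =
      ∑ j, shearMatrix p j i • shearComp p (partialDeriv j φ) := by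
  ext x
  have hg : HasFDerivAt (fun x => matMap (shearMatrix p) (x - p.1)) (matMap (shearMatrix p)) x := by
    simp only [map_sub]
    exact (matMap (shearMatrix p)).hasFDerivAt.sub_const _
  have hx := (φ.hasFDerivAt (matMap (shearMatrix p) (x - p.1))).comp x hg
  simp only [Function.comp_def] at hx
  have hfun : ⇑(shearComp p φ) = fun x => φ (matMap (shearMatrix p) (x - p.1)) :=
    funext fun x => shearComp_apply hp φ x
  rw [partialDeriv_apply, hfun, hx.fderiv, ContinuousLinearMap.comp_apply,
    fderiv_eq_sum_partialDeriv]
  simp only [matMap_apply, Fin.sum_univ_two, add_apply, smul_apply,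
    shearComp_apply hp]
  fin_cases i <;> simp [stdVec]

theorem coordMul_shearComp {p : E2 × ℝ × ℝ} (hp : p.2.2 ≠ 0) (φ : 𝓢(E2, ℂ)) (i : Fin 2) :
    coordMul i (shearComp p φ) =
      ∑ j, shearMatrixInv p i j • shearComp p (coordMul j φ) + p.1 i • shearComp p φ := by
  ext x
  have hx : x i = ∑ j, shearMatrixInv p i j * (matMap (shearMatrix p) (x - p.1)) j + p.1 i := by
    rw [← matMap_apply, matMap_shearMatrixInv_apply hp]
    simp
  rw [coordMul_apply, hx]
  simp only [Fin.sum_univ_two, add_apply, smul_apply,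
    shearComp_apply hp, coordMul_apply, add_smul, mul_smul]

/-- The domain of the shearlet transform. -/
def shearletGroup : Set (E2 × ℝ × ℝ) := {p | p.2.2 ≠ 0}

/-- The weight measuring polynomial growth on the shearlet group. -/
def growthWeight (p : E2 × ℝ × ℝ) : ℝ := jp p.1 * jp p.2.1 * (|p.2.2| + |p.2.2|⁻¹)

theorem one_le_jp {E : Type*} [NormedAddCommGroup E] (x : E) : 1 ≤ jp x :=
  Real.one_le_sqrt.2 (by nlinarith [sq_nonneg ‖x‖])

theorem norm_le_jp {E : Type*} [NormedAddCommGroup E] (x : E) : ‖x‖ ≤ jp x :=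
  Real.le_sqrt_of_sq_le (by linarith)

theorem rpow_le_add_inv {x r : ℝ} (hx : 0 < x) (hr : |r| ≤ 1) : x ^ r ≤ x + x⁻¹ := by
  rw [abs_le] at hr
  have hinv : 0 < x⁻¹ := inv_pos.2 hx
  rcases le_total 1 x with h | h
  · have := Real.rpow_le_rpow_of_exponent_le h hr.2
    rw [Real.rpow_one] at this
    linarith
  · have := Real.rpow_le_rpow_of_exponent_ge hx h hr.1
    rw [Real.rpow_neg_one] at this
    linarith

theorem one_le_add_inv {x : ℝ} (hx : 0 < x) : 1 ≤ x + x⁻¹ := by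
  simpa using rpow_le_add_inv hx (r := 0) (by simp)

theorem le_growthWeight_of_le_scale {p : E2 × ℝ × ℝ} {t : ℝ} (hp : p ∈ shearletGroup)
    (ht : t ≤ |p.2.2| + |p.2.2|⁻¹) : t ≤ growthWeight p := by
  have h := one_le_add_inv (abs_pos.2 hp)
  have h' := one_le_mul_of_one_le_of_one_le (one_le_jp p.1) (one_le_jp p.2.1)
  exact ht.trans (le_mul_of_one_le_left (by linarith) h')

theorem one_le_growthWeight {p : E2 × ℝ × ℝ} (hp : p ∈ shearletGroup) : 1 ≤ growthWeight p :=
  le_growthWeight_of_le_scale hp (one_le_add_inv (abs_pos.2 hp))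

theorem jp_fst_le_growthWeight {p : E2 × ℝ × ℝ} (hp : p ∈ shearletGroup) :
    jp p.1 ≤ growthWeight p := by
  have h := one_le_add_inv (abs_pos.2 hp)
  have hb := one_le_jp p.1
  rw [growthWeight, mul_assoc]
  exact le_mul_of_one_le_right (by linarith)
    (one_le_mul_of_one_le_of_one_le (one_le_jp p.2.1) h)

theorem jp_shear_le_growthWeight {p : E2 × ℝ × ℝ} (hp : p ∈ shearletGroup) :
    jp p.2.1 ≤ growthWeight p := by
  have h := one_le_add_inv (abs_pos.2 hp)
  have hs := one_le_jp p.2.1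
  rw [growthWeight, mul_comm (jp p.1), mul_assoc]
  exact le_mul_of_one_le_right (by linarith)
    (one_le_mul_of_one_le_of_one_le (one_le_jp p.1) h)

/-- Smooth functions on the shearlet group of at most polynomial growth. -/
structure IsModerate {B : Type*} [NormedAddCommGroup B] [NormedSpace ℝ B]
    (h : E2 × ℝ × ℝ → B) : Prop where
  contDiffOn : ContDiffOn ℝ ∞ h shearletGroup
  bound : ∃ (C : ℝ) (n : ℕ), ∀ p ∈ shearletGroup, ‖h p‖ ≤ C * growthWeight p ^ n

namespace IsModerate

variable {B B' : Type*} [NormedAddCommGroup B] [NormedSpace ℝ B]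
  [NormedAddCommGroup B'] [NormedSpace ℝ B'] {h k : E2 × ℝ × ℝ → B}

theorem exists_bound_le (hh : IsModerate h) : ∃ (C : ℝ) (n : ℕ), 0 ≤ C ∧
    ∀ m, n ≤ m → ∀ p ∈ shearletGroup, ‖h p‖ ≤ C * growthWeight p ^ m := by
  obtain ⟨C, n, hC⟩ := hh.bound
  refine ⟨|C|, n, abs_nonneg C, fun m hm p hp => (hC p hp).trans ?_⟩
  have h1 := one_le_growthWeight hp
  have h0 : 0 ≤ growthWeight p := zero_le_one.trans h1
  calc C * growthWeight p ^ n ≤ |C| * growthWeight p ^ n := by gcongr; exact le_abs_self C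
    _ ≤ |C| * growthWeight p ^ m := by gcongr

theorem congr (hh : IsModerate h) (hk : ∀ p ∈ shearletGroup, k p = h p) : IsModerate k := by
  refine ⟨hh.contDiffOn.congr hk, ?_⟩
  obtain ⟨C, n, hC⟩ := hh.bound
  exact ⟨C, n, fun p hp => by rw [hk p hp]; exact hC p hp⟩

theorem const (c : B) : IsModerate fun _ => c :=
  ⟨contDiffOn_const, ‖c‖, 0, fun p _ => by simp⟩

theorem of_norm_le (hh : ContDiffOn ℝ ∞ h shearletGroup)
    (hb : ∀ p ∈ shearletGroup, ‖h p‖ ≤ growthWeight p) : IsModerate h :=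
  ⟨hh, 1, 1, fun p hp => by simpa using hb p hp⟩

theorem add (hh : IsModerate h) (hk : IsModerate k) : IsModerate fun p => h p + k p := by
  refine ⟨hh.contDiffOn.add hk.contDiffOn, ?_⟩
  obtain ⟨C, n, hC0, hC⟩ := hh.exists_bound_le
  obtain ⟨D, m, hD0, hD⟩ := hk.exists_bound_le
  refine ⟨C + D, max n m, fun p hp => (norm_add_le _ _).trans ?_⟩
  rw [add_mul]
  exact add_le_add (hC _ (le_max_left _ _) p hp) (hD _ (le_max_right _ _) p hp)

theorem smul {c : E2 × ℝ × ℝ → ℝ} (hc : IsModerate c) (hh : IsModerate h) :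
    IsModerate fun p => c p • h p := by
  refine ⟨hc.contDiffOn.smul hh.contDiffOn, ?_⟩
  obtain ⟨C, n, hC0, hC⟩ := hc.exists_bound_le
  obtain ⟨D, m, hD0, hD⟩ := hh.exists_bound_le
  refine ⟨C * D, n + m, fun p hp => ?_⟩
  have h0 : 0 ≤ growthWeight p := zero_le_one.trans (one_le_growthWeight hp)
  calc ‖c p • h p‖ = ‖c p‖ * ‖h p‖ := norm_smul _ _
    _ ≤ (C * growthWeight p ^ n) * (D * growthWeight p ^ m) :=
      mul_le_mul (hC n le_rfl p hp) (hD m le_rfl p hp) (norm_nonneg _) (by positivity)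
    _ = C * D * growthWeight p ^ (n + m) := by ring

theorem mul {c d : E2 × ℝ × ℝ → ℝ} (hc : IsModerate c) (hd : IsModerate d) :
    IsModerate fun p => c p * d p :=
  hc.smul hd

theorem sum {ι : Type*} (s : Finset ι) {h : ι → E2 × ℝ × ℝ → B}
    (hh : ∀ i ∈ s, IsModerate (h i)) : IsModerate fun p => ∑ i ∈ s, h i p := by
  classical
  induction s using Finset.induction_on with
  | empty => simpa using const (0 : B)
  | insert i s hi ih =>
    simp only [Finset.sum_insert hi]
    exact (hh i (Finset.mem_insert_self i s)).add
      (ih fun j hj => hh j (Finset.mem_insert_of_mem hj))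

theorem clm_comp (L : B →L[ℝ] B') (hh : IsModerate h) : IsModerate fun p => L (h p) := by
  refine ⟨L.contDiff.comp_contDiffOn hh.contDiffOn, ?_⟩
  obtain ⟨C, n, hC⟩ := hh.bound
  refine ⟨‖L‖ * C, n, fun p hp => (L.le_opNorm _).trans ?_⟩
  rw [mul_assoc]
  gcongr
  exact hC p hp

theorem prodMk {k : E2 × ℝ × ℝ → B'} (hh : IsModerate h) (hk : IsModerate k) :
    IsModerate fun p => (h p, k p) :=
  ((hh.clm_comp (ContinuousLinearMap.inl ℝ B B')).add
    (hk.clm_comp (ContinuousLinearMap.inr ℝ B B'))).congr fun p _ => by simp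

end IsModerate

theorem isModerate_scale : IsModerate fun p => p.2.2 := by
  refine .of_norm_le (by fun_prop) fun p hp => le_growthWeight_of_le_scale hp ?_
  have : 0 ≤ |p.2.2|⁻¹ := by positivity
  rw [Real.norm_eq_abs]
  linarith

theorem isModerate_inv_scale : IsModerate fun p => p.2.2⁻¹ := by
  refine .of_norm_le (ContDiffOn.inv (by fun_prop) fun p hp => hp)
    fun p hp => le_growthWeight_of_le_scale hp ?_
  rw [norm_inv, Real.norm_eq_abs]
  exact le_add_of_nonneg_left (abs_nonneg _)

theorem isModerate_abs_scale_rpow {r : ℝ} (hr : |r| ≤ 1) : IsModerate fun p => |p.2.2| ^ r := by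
  refine .of_norm_le (fun p hp => ?_) fun p hp => le_growthWeight_of_le_scale hp ?_
  · have habs : ContDiffAt ℝ ∞ (fun p : E2 × ℝ × ℝ => |p.2.2|) p :=
      (contDiffAt_abs hp).comp p (f := fun p : E2 × ℝ × ℝ => p.2.2) (by fun_prop)
    exact (habs.rpow_const_of_ne (abs_ne_zero.2 hp)).contDiffWithinAt
  · rw [Real.norm_of_nonneg (by positivity)]
    exact rpow_le_add_inv (abs_pos.2 hp) hr

theorem isModerate_shear : IsModerate fun p => p.2.1 :=
  .of_norm_le (by fun_prop) fun p hp => (norm_le_jp p.2.1).trans (jp_shear_le_growthWeight hp)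

theorem isModerate_translation (i : Fin 2) : IsModerate fun p => p.1 i :=
  .of_norm_le (by fun_prop) fun p hp =>
    (PiLp.norm_apply_le p.1 i).trans ((norm_le_jp p.1).trans (jp_fst_le_growthWeight hp))

theorem isModerate_shearMatrix (i j : Fin 2) : IsModerate fun p => shearMatrix p i j := by
  fin_cases i <;> fin_cases j <;> simp only [shearMatrix]
  · exact isModerate_inv_scale
  · exact isModerate_shear.mul isModerate_inv_scale
  · exact .const 0
  · exact (isModerate_abs_scale_rpow (by norm_num [abs_le])).mul isModerate_inv_scale

theorem isModerate_shearMatrixInv (i j : Fin 2) : IsModerate fun p => shearMatrixInv p i j := by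
  have hs := isModerate_scale.mul
    (isModerate_abs_scale_rpow (r := -(1 / 2)) (by norm_num [abs_le]))
  fin_cases i <;> fin_cases j <;> simp only [shearMatrixInv]
  · exact isModerate_scale
  · exact (IsModerate.const (-1)).mul (isModerate_shear.mul hs)
  · exact .const 0
  · exact hs

theorem contDiffOn_shearParam : ContDiffOn ℝ ∞ shearParam shearletGroup := by
  have hM : ContDiffOn ℝ ∞ (fun p => matMap (shearMatrix p)) shearletGroup :=
    ContDiffOn.sum fun i _ => ContDiffOn.sum fun j _ =>
      (isModerate_shearMatrix i j).contDiffOn.smul contDiffOn_const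
  exact hM.prodMk (hM.clm_apply contDiffOn_fst).neg

/-- A linear map on Schwartz functions is moderate along the shearlet group if its composition
with the action of the group is smooth and of at most polynomial growth on every orbit. -/
def IsModerateOnOrbits {B : Type*} [NormedAddCommGroup B] [NormedSpace ℝ B]
    (A : 𝓢(E2, ℂ) →ₗ[ℝ] B) : Prop :=
  ∀ φ, IsModerate fun p => A (shearComp p φ)

theorem isModerateOnOrbits_toBoundedContinuousFunction :
    IsModerateOnOrbits (toBoundedContinuousFunctionCLM ℝ E2 ℂ).toLinearMap := by
  intro φ
  have h : ContDiffOn ℝ ∞ (fun p => affinePullback φ (shearParam p)) shearletGroup :=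
    (contDiffOn_affinePullback φ).comp contDiffOn_shearParam
      fun p hp => shearParam_mem_invertibleParams hp
  have hmod : IsModerate fun p => affinePullback φ (shearParam p) := by
    refine ⟨h, ‖φ.toBoundedContinuousFunction‖, 0, fun p _ => ?_⟩
    rw [pow_zero, mul_one]
    exact (BoundedContinuousFunction.norm_le (norm_nonneg _)).2 fun x =>
      φ.toBoundedContinuousFunction.norm_coe_le_norm _
  refine hmod.congr fun p hp => ?_
  ext x
  rw [affinePullback_apply, shearParam_apply]
  exact shearComp_apply hp φ x

namespace IsModerateOnOrbits

variable {B B' : Type*} [NormedAddCommGroup B] [NormedSpace ℝ B]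
  [NormedAddCommGroup B'] [NormedSpace ℝ B'] {A : 𝓢(E2, ℂ) →ₗ[ℝ] B}

theorem comp_partialDeriv (hA : IsModerateOnOrbits A) (i : Fin 2) :
    IsModerateOnOrbits (A.comp (partialDeriv i)) := fun φ =>
  (IsModerate.sum Finset.univ fun j _ =>
    (isModerate_shearMatrix j i).smul (hA (partialDeriv j φ))).congr fun p hp => by
      rw [LinearMap.comp_apply, partialDeriv_shearComp hp, map_sum]
      simp only [map_smul]

theorem comp_coordMul (hA : IsModerateOnOrbits A) (i : Fin 2) :
    IsModerateOnOrbits (A.comp (coordMul i)) := fun φ =>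
  ((IsModerate.sum Finset.univ fun j _ =>
    (isModerate_shearMatrixInv i j).smul (hA (coordMul j φ))).add
      ((isModerate_translation i).smul (hA φ))).congr fun p hp => by
      rw [LinearMap.comp_apply, coordMul_shearComp hp, map_add, map_sum]
      simp only [map_smul]

theorem const_smul (hA : IsModerateOnOrbits A) (c : ℝ) : IsModerateOnOrbits (c • A) := fun φ =>
  (IsModerate.const c).smul (hA φ)

theorem prod {A' : 𝓢(E2, ℂ) →ₗ[ℝ] B'} (hA : IsModerateOnOrbits A)
    (hA' : IsModerateOnOrbits A') : IsModerateOnOrbits (A.prod A') := fun φ =>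
  (hA φ).prodMk (hA' φ)

/-- By the Hahn-Banach theorem, a functional dominated by a linear map that is moderate on orbits
factors through it, and hence is moderate on orbits. -/
theorem of_abs_le (hA : IsModerateOnOrbits A) (l : 𝓢(E2, ℂ) →ₗ[ℝ] ℝ)
    (hl : ∀ φ, |l φ| ≤ ‖A φ‖) : IsModerateOnOrbits l := by
  obtain ⟨g, hg⟩ := A.rangeRestrict.exists_rightInverse_of_surjective A.range_rangeRestrict
  have hAg : ∀ y : LinearMap.range A, A (g y) = y := fun y =>
    congrArg Subtype.val (LinearMap.congr_fun hg y)
  obtain ⟨L, hL, -⟩ := exists_extension_norm_eq (𝕜 := ℝ) (LinearMap.range A)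
    ((l.comp g).mkContinuous 1 fun y => by
      simpa [hAg] using hl (g y))
  have hfactor : ∀ φ, l φ = L (A φ) := by
    intro φ
    have h1 : L (A φ) = l (g (A.rangeRestrict φ)) := hL (A.rangeRestrict φ)
    have h2 := hl (φ - g (A.rangeRestrict φ))
    rw [map_sub A, hAg, LinearMap.codRestrict_apply, sub_self, norm_zero, map_sub] at h2
    rw [h1]
    exact sub_eq_zero.1 (abs_nonpos_iff.1 h2)
  exact fun φ => ((hA φ).clm_comp L).congr fun p _ => hfactor _

end IsModerateOnOrbits

/-- Functions on the Schwartz space dominated by the norm of a linear map that is moderate on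
orbits. -/
def IsDominated (q : 𝓢(E2, ℂ) → ℝ) : Prop :=
  ∃ (B : Type) (_ : NormedAddCommGroup B) (_ : NormedSpace ℝ B) (A : 𝓢(E2, ℂ) →ₗ[ℝ] B),
    IsModerateOnOrbits A ∧ ∀ φ, q φ ≤ ‖A φ‖

namespace IsDominated

variable {q r : 𝓢(E2, ℂ) → ℝ}

theorem mono (hq : IsDominated q) (hr : ∀ φ, r φ ≤ q φ) : IsDominated r := by
  obtain ⟨B, i₁, i₂, A, hA, hAq⟩ := hq
  exact ⟨B, i₁, i₂, A, hA, fun φ => (hr φ).trans (hAq φ)⟩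

theorem zero : IsDominated fun _ => 0 := by
  obtain hA := isModerateOnOrbits_toBoundedContinuousFunction
  exact ⟨_, _, _, _, hA, fun φ => norm_nonneg _⟩

theorem const_mul (hq : IsDominated q) {c : ℝ} (hc : 0 ≤ c) :
    IsDominated fun φ => c * q φ := by
  obtain ⟨B, i₁, i₂, A, hA, hAq⟩ := hq
  refine ⟨B, i₁, i₂, c • A, hA.const_smul c, fun φ => ?_⟩
  rw [LinearMap.smul_apply, norm_smul, Real.norm_of_nonneg hc]
  exact mul_le_mul_of_nonneg_left (hAq φ) hc

theorem add (hq : IsDominated q) (hr : IsDominated r) : IsDominated fun φ => q φ + r φ := by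
  obtain ⟨B, i₁, i₂, A, hA, hAq⟩ := hq.const_mul zero_le_two
  obtain ⟨B', i₁', i₂', A', hA', hAr⟩ := hr.const_mul zero_le_two
  refine ⟨B × B', inferInstance, inferInstance, A.prod A', hA.prod hA', fun φ => ?_⟩
  have h1 : ‖A φ‖ ≤ ‖A.prod A' φ‖ := norm_fst_le (A φ, A' φ)
  have h2 : ‖A' φ‖ ≤ ‖A.prod A' φ‖ := norm_snd_le (A φ, A' φ)
  linarith [hAq φ, hAr φ]

theorem sum {ι : Type*} (s : Finset ι) {q : ι → 𝓢(E2, ℂ) → ℝ} (hq : ∀ i, IsDominated (q i)) :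
    IsDominated fun φ => ∑ i ∈ s, q i φ := by
  classical
  induction s using Finset.induction_on with
  | empty => simpa using zero
  | insert i s hi ih =>
    simp only [Finset.sum_insert hi]
    exact (hq i).add ih

theorem comp_partialDeriv (hq : IsDominated q) (i : Fin 2) :
    IsDominated fun φ => q (partialDeriv i φ) := by
  obtain ⟨B, i₁, i₂, A, hA, hAq⟩ := hq
  exact ⟨B, i₁, i₂, _, hA.comp_partialDeriv i, fun φ => hAq _⟩

theorem comp_coordMul (hq : IsDominated q) (i : Fin 2) :
    IsDominated fun φ => q (coordMul i φ) := by
  obtain ⟨B, i₁, i₂, A, hA, hAq⟩ := hq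
  exact ⟨B, i₁, i₂, _, hA.comp_coordMul i, fun φ => hAq _⟩

end IsDominated

theorem seminorm_succ_zero_le (k : ℕ) (φ : 𝓢(E2, ℂ)) :
    SchwartzMap.seminorm ℂ (k + 1) 0 φ ≤ ∑ j, SchwartzMap.seminorm ℂ k 0 (coordMul j φ) := by
  refine seminorm_le_bound ℂ _ _ φ (by positivity) fun x => ?_
  have hx : ‖x‖ ≤ ∑ j, |x j| := by
    calc ‖x‖ = ‖∑ j, x j • stdVec j‖ := by rw [sum_smul_stdVec]
      _ ≤ ∑ j, ‖x j • stdVec j‖ := norm_sum_le _ _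
      _ = ∑ j, |x j| := by simp [norm_smul, stdVec]
  rw [norm_iteratedFDeriv_zero]
  calc ‖x‖ ^ (k + 1) * ‖φ x‖ = ‖x‖ ^ k * (‖x‖ * ‖φ x‖) := by ring
    _ ≤ ‖x‖ ^ k * ((∑ j, |x j|) * ‖φ x‖) := by gcongr
    _ = ∑ j, ‖x‖ ^ k * ‖coordMul j φ x‖ := by
      simp only [coordMul_apply, norm_smul, Real.norm_eq_abs, Finset.sum_mul, Finset.mul_sum]
    _ ≤ _ := Finset.sum_le_sum fun j _ => norm_pow_mul_le_seminorm ℂ (coordMul j φ) k x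

theorem seminorm_succ_le (k n : ℕ) (φ : 𝓢(E2, ℂ)) :
    SchwartzMap.seminorm ℂ k (n + 1) φ ≤
      ∑ i, SchwartzMap.seminorm ℂ k n (partialDeriv i φ) := by
  refine seminorm_le_bound ℂ _ _ φ (by positivity) fun x => ?_
  let T : Fin 2 → ℂ →L[ℝ] E2 →L[ℝ] ℂ := fun i =>
    ContinuousLinearMap.smulRightL ℝ E2 ℂ (EuclideanSpace.proj i)
  have hT : ∀ i, ‖T i‖ ≤ 1 := fun i =>
    ContinuousLinearMap.opNorm_le_bound _ zero_le_one fun c => by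
      refine ContinuousLinearMap.opNorm_le_bound _ (by positivity) fun y => ?_
      have : T i c y = y i • c := rfl
      rw [this, norm_smul, one_mul, mul_comm]
      gcongr
      exact PiLp.norm_apply_le y i
  have hφ : fderiv ℝ φ = fun y => ∑ i, T i (partialDeriv i φ y) := by
    funext y
    ext k
    rw [fderiv_eq_sum_partialDeriv, Fin.sum_univ_two, Fin.sum_univ_two]
    rfl
  have hsm : ∀ i, ContDiff ℝ n fun y => T i (partialDeriv i φ y) := fun i =>
    (T i).contDiff.comp ((partialDeriv i φ).smooth n)
  rw [← norm_iteratedFDeriv_fderiv, hφ, iteratedFDeriv_fun_sum_apply fun i _ => (hsm i).contDiffAt]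
  calc _ ≤ ‖x‖ ^ k * ∑ i, ‖iteratedFDeriv ℝ n (fun y => T i (partialDeriv i φ y)) x‖ := by
        gcongr
        exact norm_sum_le _ _
    _ ≤ ‖x‖ ^ k * ∑ i, ‖iteratedFDeriv ℝ n (partialDeriv i φ) x‖ := by
        gcongr with i
        refine ((T i).norm_iteratedFDeriv_comp_left
          ((partialDeriv i φ).contDiffAt n) le_rfl).trans ?_
        exact mul_le_of_le_one_left (norm_nonneg _) (hT i)
    _ = ∑ i, ‖x‖ ^ k * ‖iteratedFDeriv ℝ n (partialDeriv i φ) x‖ := Finset.mul_sum _ _ _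
    _ ≤ _ := Finset.sum_le_sum fun i _ => le_seminorm ℂ k n (partialDeriv i φ) x

theorem isDominated_seminorm (k n : ℕ) : IsDominated (SchwartzMap.seminorm ℂ k n) := by
  induction n with
  | zero =>
    induction k with
    | zero =>
      refine ⟨_, _, _, _, isModerateOnOrbits_toBoundedContinuousFunction, fun φ => ?_⟩
      refine seminorm_le_bound ℂ 0 0 φ (norm_nonneg _) fun x => ?_
      rw [pow_zero, one_mul, norm_iteratedFDeriv_zero]
      exact φ.toBoundedContinuousFunction.norm_coe_le_norm x
    | succ k ih =>
      exact (IsDominated.sum Finset.univ fun j => ih.comp_coordMul j).mono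
        (seminorm_succ_zero_le k)
  | succ n ih =>
    exact (IsDominated.sum Finset.univ fun j => ih.comp_partialDeriv j).mono (seminorm_succ_le k n)

theorem isDominated_norm_apply (f : 𝓢(E2, ℂ) →L[ℂ] ℂ) : IsDominated fun φ => ‖f φ‖ := by
  obtain ⟨s, C, -, hC⟩ := Seminorm.bound_of_continuous (schwartz_withSeminorms ℂ E2 ℂ)
    ((normSeminorm ℂ ℂ).comp f.toLinearMap) (continuous_norm.comp f.continuous)
  refine ((IsDominated.sum s fun i => isDominated_seminorm i.1 i.2).const_mul C.coe_nonneg).mono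
    fun φ => (hC φ).trans ?_
  have hs := Seminorm.finset_sup_le_sum (schwartzSeminormFamily ℂ E2 ℂ) s φ
  rw [← FunLike.coeAddMonoidHom_apply (∑ i ∈ s, schwartzSeminormFamily ℂ E2 ℂ i), map_sum,
    Finset.sum_apply] at hs
  exact mul_le_mul_of_nonneg_left hs C.coe_nonneg

theorem isModerate_apply_shearComp (f : 𝓢(E2, ℂ) →L[ℂ] ℂ) (φ : 𝓢(E2, ℂ)) :
    IsModerate fun p => f (shearComp p φ) := by
  obtain ⟨B, _, _, A, hA, hAf⟩ := isDominated_norm_apply f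
  let fR : 𝓢(E2, ℂ) →ₗ[ℝ] ℂ := f.toLinearMap.restrictScalars ℝ
  have hre := hA.of_abs_le (Complex.reLm.comp fR)
    (fun φ => (Complex.abs_re_le_norm _).trans (hAf φ)) φ
  have him := hA.of_abs_le (Complex.imLm.comp fR)
    (fun φ => (Complex.abs_im_le_norm _).trans (hAf φ)) φ
  refine ((hre.smul (.const (1 : ℂ))).add (him.smul (.const Complex.I))).congr fun p _ => ?_
  simp only [Complex.real_smul, mul_one]
  exact (Complex.re_add_im _).symm

/-- the shearlet transform of a tempered (Lizorkin) distribution is a smooth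
function of at most polynomial growth on the shearlet group. -/
theorem distributional_shearlet_polynomial_growth
    (ψ : SchwartzMap E2 ℂ)
    (hψ : ∀ m₁ m₂ : ℕ, ∫ x : E2, ((x 0) ^ m₁ * (x 1) ^ m₂ : ℝ) • ψ x = 0)
    (f : SchwartzMap E2 ℂ →L[ℂ] ℂ)
    (rep : E2 → ℝ → ℝ → SchwartzMap E2 ℂ)
    (hrep : ∀ (b : E2) (s a : ℝ), a ≠ 0 → ⇑(rep b s a) = srep (⇑ψ) b s a) :
    ContDiffOn ℝ (⊤ : ℕ∞) (fun p : E2 × ℝ × ℝ => f (rep p.1 p.2.1 p.2.2))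
        {p : E2 × ℝ × ℝ | p.2.2 ≠ 0} ∧
    ∃ (C ν₁ ν₂ ν₃ : ℝ), 0 < C ∧ 0 < ν₁ ∧ 0 < ν₂ ∧ 0 < ν₃ ∧
      ∀ (b : E2) (s a : ℝ), a ≠ 0 →
        ‖f (rep b s a)‖ ≤ C * jp b ^ ν₁ * jp s ^ ν₂ * (|a| ^ ν₃ + |a| ^ (-ν₃)) := by
  have hmod : IsModerate fun p : E2 × ℝ × ℝ => f (rep p.1 p.2.1 p.2.2) := by
    refine ((isModerate_abs_scale_rpow (r := -(3 : ℝ) / 4) (by norm_num [abs_le])).smul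
      (isModerate_apply_shearComp f ψ)).congr fun p hp => ?_
    have : rep p.1 p.2.1 p.2.2 = (|p.2.2| ^ (-(3 : ℝ) / 4)) • shearComp p ψ := by
      ext x
      rw [hrep _ _ _ hp, srep_eq_shearComp ψ hp, smul_apply]
    rw [this]
    exact map_smul (f.toLinearMap.restrictScalars ℝ) _ _
  refine ⟨hmod.contDiffOn, ?_⟩
  obtain ⟨C, n, hC0, hC⟩ := hmod.exists_bound_le
  refine ⟨(C + 1) * 2 ^ n, (n + 1 : ℕ), (n + 1 : ℕ), (n + 1 : ℕ), by positivity,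
    by positivity, by positivity, by positivity, fun b s a ha => ?_⟩
  have ha' : 0 < |a| := abs_pos.2 ha
  have hjb := one_le_jp b
  have hjs := one_le_jp s
  have h := hC (n + 1) n.le_succ (b, s, a) ha
  simp only [growthWeight] at h
  rw [Real.rpow_neg ha'.le]
  simp only [Real.rpow_natCast]
  have hpow : (|a| + |a|⁻¹) ^ (n + 1) ≤ 2 ^ n * (|a| ^ (n + 1) + (|a| ^ (n + 1))⁻¹) := by
    rw [← inv_pow]
    exact add_pow_le ha'.le (inv_nonneg.2 ha'.le) (n + 1)
  calc ‖f (rep b s a)‖ ≤ C * (jp b * jp s * (|a| + |a|⁻¹)) ^ (n + 1) := h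
    _ = C * (jp b ^ (n + 1) * jp s ^ (n + 1)) * (|a| + |a|⁻¹) ^ (n + 1) := by
      rw [mul_pow, mul_pow]; ring
    _ ≤ (C + 1) * (jp b ^ (n + 1) * jp s ^ (n + 1)) *
        (2 ^ n * (|a| ^ (n + 1) + (|a| ^ (n + 1))⁻¹)) := by
      gcongr
      linarith
    _ = _ := by ring

end
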